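/- arXiv:2005.14334 — 3 statements merged into one kernel-verified Lean document; each statement's English description precedes it below -/
import Mathlib

section
/- Let N ≥ 11 be an integer and let Ψ : (0,1] → ℝ be a continuous nonincreasing function satisfying 2(N−2)/r² ≤ Ψ(r) ≤ (N−2)²/(4r²) for every r ∈ (0,1]. Then there exist a C¹ function f : [0,∞) → ℝ satisfying condition (★) and a C³ function u : (0,1] → ℝ such that: u(1) = 0; u'(r) < 0 for every r ∈ (0,1]; lim_{r→0⁺} u(r) = +∞; ∫₀¹ r^{N−1}(u(r)² + u'(r)²) dr < ∞; −u''(r) − ((N−1)/r)·u'(r) = f(u(r)) for every r ∈ (0,1]; and f'(u(r)) = Ψ(r) for every r ∈ (0,1]. -/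
open MeasureTheory Filter Set

/-- Condition (★): `f` is `C¹`, nondecreasing, convex, `f 0 > 0`, and superlinear at `+∞`,
all on the domain `[0,∞)`. -/
def StarCond (f : ℝ → ℝ) : Prop :=
  ContDiffOn ℝ 1 f (Set.Ici 0) ∧ MonotoneOn f (Set.Ici 0) ∧
    ConvexOn ℝ (Set.Ici 0) f ∧ 0 < f 0 ∧
    Tendsto (fun t => f t / t) atTop atTop

/-- The bounded solution of `S' = k S - g` for `k > 0` and bounded continuous `g`. -/
noncomputable def boundedSolution (k : ℝ) (g : ℝ → ℝ) (t : ℝ) : ℝ :=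
  Real.exp (k * t) * ∫ s in Ioi t, Real.exp (-k * s) * g s

theorem integrableOn_exp_mul_of_bounded {k : ℝ} (hk : 0 < k) {g : ℝ → ℝ} (hg : Continuous g)
    {C : ℝ} (hC : ∀ t, |g t| ≤ C) (t : ℝ) :
    IntegrableOn (fun s => Real.exp (-k * s) * g s) (Ioi t) := by
  refine Integrable.mul_bdd (c := C) (integrableOn_exp_mul_Ioi (by linarith) t)
    hg.aestronglyMeasurable ?_
  exact Eventually.of_forall hC

theorem hasDerivAt_boundedSolution {k : ℝ} (hk : 0 < k) {g : ℝ → ℝ} (hg : Continuous g)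
    {C : ℝ} (hC : ∀ t, |g t| ≤ C) (t : ℝ) :
    HasDerivAt (boundedSolution k g) (k * boundedSolution k g t - g t) t := by
  have hint := integrableOn_exp_mul_of_bounded hk hg hC
  have hcont : Continuous fun s => Real.exp (-k * s) * g s := by fun_prop
  have hI : HasDerivAt (fun x => ∫ s in Ioi x, Real.exp (-k * s) * g s)
      (-(Real.exp (-k * t) * g t)) t := by
    have hd := ((hcont.integral_hasStrictDerivAt 0 t).hasDerivAt).const_sub
      (∫ s in Ioi 0, Real.exp (-k * s) * g s)
    refine hd.congr_of_eventuallyEq (Eventually.of_forall fun x => ?_)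
    have := intervalIntegral.integral_Ioi_sub_Ioi' (hint 0) (hint x)
    simp only
    linarith
  have hE : HasDerivAt (fun x => Real.exp (k * x)) (Real.exp (k * t) * k) t := by
    simpa using ((hasDerivAt_id t).const_mul k).exp
  refine (hE.mul hI).congr_deriv ?_
  have : Real.exp (k * t) * Real.exp (-k * t) = 1 := by
    rw [← Real.exp_add]; simp
  simp only [boundedSolution]
  linear_combination (-g t) * this

theorem boundedSolution_mono {k : ℝ} (hk : 0 < k) {g h : ℝ → ℝ} (hg : Continuous g)
    (hh : Continuous h) {C D : ℝ} (hC : ∀ t, |g t| ≤ C) (hD : ∀ t, |h t| ≤ D)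
    (hgh : ∀ t, g t ≤ h t) (t : ℝ) : boundedSolution k g t ≤ boundedSolution k h t := by
  unfold boundedSolution
  gcongr
  · exact integrableOn_exp_mul_of_bounded hk hg hC t
  · exact integrableOn_exp_mul_of_bounded hk hh hD t
  · exact measurableSet_Ioi.nullMeasurableSet
  · exact hgh _

theorem boundedSolution_sub {k : ℝ} (hk : 0 < k) {g h : ℝ → ℝ} (hg : Continuous g)
    (hh : Continuous h) {C D : ℝ} (hC : ∀ t, |g t| ≤ C) (hD : ∀ t, |h t| ≤ D) (t : ℝ) :
    boundedSolution k (fun s => g s - h s) t = boundedSolution k g t - boundedSolution k h t := by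
  simp only [boundedSolution, mul_sub]
  rw [integral_sub (integrableOn_exp_mul_of_bounded hk hg hC t)
    (integrableOn_exp_mul_of_bounded hk hh hD t), mul_sub]

theorem boundedSolution_const {k : ℝ} (hk : 0 < k) (c t : ℝ) :
    boundedSolution k (fun _ => c) t = c / k := by
  have : Real.exp (k * t) * Real.exp (-k * t) = 1 := by
    rw [← Real.exp_add]; simp
  simp only [boundedSolution]
  rw [integral_mul_const, integral_exp_mul_Ioi (by linarith)]
  field_simp
  simp only [neg_mul] at this ⊢
  linear_combination c * this

theorem le_boundedSolution {k : ℝ} (hk : 0 < k) {g : ℝ → ℝ} (hg : Continuous g)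
    {C : ℝ} (hC : ∀ t, |g t| ≤ C) {c : ℝ} (hc : ∀ t, c ≤ g t) (t : ℝ) :
    c / k ≤ boundedSolution k g t := by
  rw [← boundedSolution_const hk c t]
  exact boundedSolution_mono hk continuous_const hg (fun _ => le_rfl) hC hc t

theorem boundedSolution_le {k : ℝ} (hk : 0 < k) {g : ℝ → ℝ} (hg : Continuous g)
    {C : ℝ} (hC : ∀ t, |g t| ≤ C) {c : ℝ} (hc : ∀ t, g t ≤ c) (t : ℝ) :
    boundedSolution k g t ≤ c / k := by
  rw [← boundedSolution_const hk c t]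
  exact boundedSolution_mono hk hg continuous_const hC (fun _ => le_rfl) hc t

/-- A Riccati equation whose right-hand side points outwards at the ends of `[1, a]` has a
global solution that stays in `[1, a]`. -/
theorem exists_riccati_solution {k a : ℝ} (ha : 1 ≤ a) (hak : 2 * a < k) {q : ℝ → ℝ}
    (hq : Continuous q) (hq1 : ∀ t, k - 1 ≤ q t) (hq2 : ∀ t, q t ≤ k * a - a ^ 2) :
    ∃ y : ℝ → ℝ, (∀ t, 1 ≤ y t ∧ y t ≤ a) ∧
      ∀ t, HasDerivAt y (k * y t - y t ^ 2 - q t) t := by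
  have hk : 0 < k := by linarith
  let cl : ℝ → ℝ := fun x => max (min x a) 1
  have hcl : Continuous cl := by fun_prop
  have hcl1 (x) : 1 ≤ cl x := le_max_right _ _
  have hcla (x) : cl x ≤ a := max_le (min_le_right _ _) ha
  have hcl_lip (x z) : |cl x - cl z| ≤ |x - z| :=
    (abs_max_sub_max_le_abs _ _ _).trans <| by
      simpa using abs_min_sub_min_le_max x a z a
  let g : BoundedContinuousFunction ℝ ℝ → ℝ → ℝ := fun y t => cl (y t) ^ 2 + q t
  have hg (y) : Continuous (g y) := by fun_prop
  have hg1 (y t) : k ≤ g y t := by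
    have := hcl1 (y t); have := hq1 t; simp only [g]; nlinarith
  have hg2 (y t) : g y t ≤ k * a := by
    have := hcl1 (y t); have := hcla (y t); have := hq2 t; simp only [g]; nlinarith
  have hgC (y t) : |g y t| ≤ k * a := by
    rw [abs_of_nonneg (hk.le.trans (hg1 y t))]; exact hg2 y t
  have hS1 (y t) : 1 ≤ boundedSolution k (g y) t := by
    simpa [hk.ne'] using le_boundedSolution hk (hg y) (hgC y) (hg1 y) t
  have hS2 (y t) : boundedSolution k (g y) t ≤ a := by
    simpa [hk.ne'] using boundedSolution_le hk (hg y) (hgC y) (hg2 y) t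
  have hd (y t) := hasDerivAt_boundedSolution hk (hg y) (hgC y) t
  let T : BoundedContinuousFunction ℝ ℝ → BoundedContinuousFunction ℝ ℝ := fun y =>
    BoundedContinuousFunction.ofNormedAddCommGroup (boundedSolution k (g y))
      (continuous_iff_continuousAt.2 fun t => (hd y t).continuousAt) a fun t => by
        rw [Real.norm_eq_abs, abs_of_nonneg (zero_le_one.trans (hS1 y t))]; exact hS2 y t
  have hT : ContractingWith (2 * a / k).toNNReal T := by
    refine ⟨?_, LipschitzWith.of_dist_le_mul fun x z => ?_⟩
    · rw [Real.toNNReal_lt_one, div_lt_one hk]; exact hak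
    rw [Real.coe_toNNReal _ (by positivity)]
    refine (BoundedContinuousFunction.dist_le (by positivity)).2 fun t => ?_
    have hle (s) : |g x s - g z s| ≤ 2 * a * dist x z := by
      have h1 := (hcl_lip (x s) (z s)).trans (BoundedContinuousFunction.dist_coe_le_dist (f := x) (g := z) s)
      have h2 : g x s - g z s = (cl (x s) + cl (z s)) * (cl (x s) - cl (z s)) := by
        simp only [g]; ring
      rw [h2, abs_mul]
      have := hcl1 (x s); have := hcl1 (z s); have := hcla (x s); have := hcla (z s)
      gcongr
      rw [abs_of_nonneg (by linarith)]; linarith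
    change |boundedSolution k (g x) t - boundedSolution k (g z) t| ≤ _
    rw [← boundedSolution_sub hk (hg x) (hg z) (hgC x) (hgC z), abs_le]
    have hc : Continuous fun s => g x s - g z s := (hg x).sub (hg z)
    have hr : 2 * a / k * dist x z = 2 * a * dist x z / k := by ring
    rw [hr, ← neg_div]
    exact ⟨le_boundedSolution hk hc hle (fun s => (abs_le.1 (hle s)).1) t,
      boundedSolution_le hk hc hle (fun s => (abs_le.1 (hle s)).2) t⟩
  let y := hT.fixedPoint
  have hy (t) : boundedSolution k (g y) t = y t :=
    congrArg (fun f : BoundedContinuousFunction ℝ ℝ => f t) hT.fixedPoint_isFixedPt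
  have hb (t) : 1 ≤ y t ∧ y t ≤ a := hy t ▸ ⟨hS1 y t, hS2 y t⟩
  refine ⟨y, hb, fun t => ?_⟩
  have h := hd y t
  rw [funext hy] at h
  refine h.congr_deriv ?_
  simp only [g, cl, min_eq_left (hb t).2, max_eq_left (hb t).1]
  ring

theorem hasDerivAt_integral_of_continuous {g : ℝ → ℝ} (hg : Continuous g) (t : ℝ) :
    HasDerivAt (fun x => ∫ s in (0 : ℝ)..x, g s) (g t) t :=
  (hg.integral_hasStrictDerivAt 0 t).hasDerivAt

theorem exists_inverse_of_one_le_deriv {z z' : ℝ → ℝ} (hz : ∀ t, HasDerivAt z (z' t) t)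
    (hz' : ∀ t, 1 ≤ z' t) :
    ∃ ζ : ℝ ≃o ℝ, (∀ t, ζ (z t) = t) ∧ ∀ x, HasDerivAt ζ (z' (ζ x))⁻¹ x := by
  have hdiff : Differentiable ℝ z := fun t => (hz t).differentiableAt
  have hgrow : ∀ ⦃s t⦄, s ≤ t → 1 * (t - s) ≤ z t - z s :=
    mul_sub_le_image_sub_of_le_deriv hdiff fun t => by rw [(hz t).deriv]; exact hz' t
  have hmono : StrictMono z := fun s t hst => by
    have := hgrow hst.le
    linarith
  have hsurj : Function.Surjective z := by
    refine hdiff.continuous.surjective ?_ ?_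
    · refine tendsto_atTop_mono' _ ?_ (tendsto_atTop_add_const_right _ (z 0) tendsto_id)
      filter_upwards [eventually_ge_atTop 0] with t ht
      have := hgrow ht
      simp only [id]; linarith
    · refine tendsto_atBot_mono' _ ?_ (tendsto_atBot_add_const_right _ (z 0) tendsto_id)
      filter_upwards [eventually_le_atBot 0] with t ht
      have := hgrow ht
      simp only [id]; linarith
  let e := hmono.orderIsoOfSurjective z hsurj
  refine ⟨e.symm, fun t => e.symm_apply_apply t, fun x => ?_⟩
  exact HasDerivAt.of_local_left_inverse e.symm.continuous.continuousAt (hz _)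
    (by have := hz' (e.symm x); positivity) (Eventually.of_forall fun y => e.apply_symm_apply y)

theorem starCond_of_hasDerivAt {f p : ℝ → ℝ} (hf : ∀ x, 0 ≤ x → HasDerivAt f (p x) x)
    (hpc : ContinuousOn p (Ici 0)) (hpm : MonotoneOn p (Ici 0)) (hp0 : ∀ x, 0 ≤ x → 0 ≤ p x)
    (hp : Tendsto p atTop atTop) (hf0 : 0 < f 0) : StarCond f := by
  have hcont : ContinuousOn f (Ici 0) := fun x hx => (hf x hx).continuousAt.continuousWithinAt
  have hdiff : DifferentiableOn ℝ f (interior (Ici 0)) := fun x hx =>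
    (hf x (interior_subset hx)).differentiableAt.differentiableWithinAt
  have hderiv : ∀ x ∈ interior (Ici (0 : ℝ)), deriv f x = p x := fun x hx =>
    (hf x (interior_subset hx)).deriv
  have hmono : MonotoneOn f (Ici 0) := monotoneOn_of_deriv_nonneg (convex_Ici 0) hcont hdiff
    fun x hx => by rw [hderiv x hx]; exact hp0 x (interior_subset hx)
  refine ⟨?_, hmono, ?_, hf0, ?_⟩
  · refine (contDiffOn_one_iff_derivWithin (uniqueDiffOn_Ici 0)).2
      ⟨fun x hx => (hf x hx).differentiableAt.differentiableWithinAt, hpc.congr fun x hx => ?_⟩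
    exact (hf x hx).hasDerivWithinAt.derivWithin (uniqueDiffOn_Ici 0 x hx)
  · refine MonotoneOn.convexOn_of_deriv (convex_Ici 0) hcont hdiff fun x hx y hy hxy => ?_
    rw [hderiv x hx, hderiv y hy]
    exact hpm (interior_subset hx) (interior_subset hy) hxy
  · have hlim : Tendsto (fun x => p (x / 2) / 2) atTop atTop :=
      (hp.comp (tendsto_id.atTop_div_const two_pos)).atTop_div_const two_pos
    refine tendsto_atTop_mono' _ ?_ hlim
    filter_upwards [eventually_gt_atTop 0] with x hx
    have hslope : p (x / 2) * (x - x / 2) ≤ f x - f (x / 2) := by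
      have hsub : Ici (x / 2) ⊆ Ici 0 := Ici_subset_Ici.2 (by linarith)
      refine (convex_Ici (x / 2)).mul_sub_le_image_sub_of_le_deriv (hcont.mono hsub)
        (hdiff.mono (interior_mono hsub)) (fun y hy => ?_) (x / 2) self_mem_Ici x
        (by simp; linarith) (by linarith)
      rw [hderiv y (interior_mono hsub hy)]
      have hy' := interior_subset hy
      exact hpm (hsub self_mem_Ici) (hsub hy') hy'
    have hhalf : 0 < f (x / 2) := hf0.trans_le
      (hmono self_mem_Ici (by simp; linarith) (by linarith))
    rw [le_div_iff₀ hx]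
    linarith

theorem contDiffOn_three_of_hasDerivWithinAt {s : Set ℝ} (hs : UniqueDiffOn ℝ s)
    {u u' u'' u''' : ℝ → ℝ} (h1 : ∀ r ∈ s, HasDerivWithinAt u (u' r) s r)
    (h2 : ∀ r ∈ s, HasDerivWithinAt u' (u'' r) s r)
    (h3 : ∀ r ∈ s, HasDerivWithinAt u'' (u''' r) s r) (hc : ContinuousOn u''' s) :
    ContDiffOn ℝ 3 u s := by
  have step {n : WithTop ℕ∞} (hn : n ≠ ⊤) {v v' : ℝ → ℝ}
      (hv : ∀ r ∈ s, HasDerivWithinAt v (v' r) s r) (hv' : ContDiffOn ℝ n v' s) :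
      ContDiffOn ℝ (n + 1) v s :=
    (contDiffOn_succ_iff_derivWithin hs).2 ⟨fun r hr => (hv r hr).differentiableWithinAt,
      fun h => absurd h hn, hv'.congr fun r hr => (hv r hr).derivWithin (hs r hr)⟩
  have := step (by decide) h1 (step (by decide) h2 (step (by decide) h3 (contDiffOn_zero.2 hc)))
  norm_num at this
  exact this

/-- The smaller root of `x ^ 2 - k x + k ^ 2 / 4 - (k + 1)`. -/
theorem exists_decay_exponent {k : ℝ} (hk : 9 ≤ k) :
    ∃ a : ℝ, 1 ≤ a ∧ 2 * a < k ∧ k * a - a ^ 2 = k ^ 2 / 4 - (k + 1) := by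
  have hsq : √(k + 1) ^ 2 = k + 1 := Real.sq_sqrt (by linarith)
  have hpos : 0 < √(k + 1) := Real.sqrt_pos.2 (by linarith)
  have hle : √(k + 1) ≤ k / 2 - 1 := Real.sqrt_le_iff.2 ⟨by linarith, by nlinarith⟩
  exact ⟨k / 2 - √(k + 1), by linarith, by linarith, by nlinarith⟩

theorem stmt15 (N : ℕ) (hN : 11 ≤ N) (Ψ : ℝ → ℝ)
    (hΨc : ContinuousOn Ψ (Set.Ioc 0 1))
    (hΨmono : AntitoneOn Ψ (Set.Ioc 0 1))
    (hΨbd : ∀ r ∈ Set.Ioc (0:ℝ) 1,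
      2 * ((N:ℝ) - 2) / r ^ 2 ≤ Ψ r ∧ Ψ r ≤ ((N:ℝ) - 2) ^ 2 / (4 * r ^ 2)) :
    ∃ f u u' u'' u''' : ℝ → ℝ,
      StarCond f ∧
      ContDiffOn ℝ 3 u (Set.Ioc 0 1) ∧
      (∀ r ∈ Set.Ioc (0:ℝ) 1, HasDerivWithinAt u (u' r) (Set.Ioc 0 1) r) ∧
      (∀ r ∈ Set.Ioc (0:ℝ) 1, HasDerivWithinAt u' (u'' r) (Set.Ioc 0 1) r) ∧
      (∀ r ∈ Set.Ioc (0:ℝ) 1, HasDerivWithinAt u'' (u''' r) (Set.Ioc 0 1) r) ∧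
      ContinuousOn u''' (Set.Ioc 0 1) ∧
      u 1 = 0 ∧
      (∀ r ∈ Set.Ioc (0:ℝ) 1, u' r < 0) ∧
      Tendsto u (nhdsWithin 0 (Set.Ioi 0)) atTop ∧
      IntervalIntegrable (fun r => r ^ (N - 1) * (u r ^ 2 + u' r ^ 2)) volume 0 1 ∧
      (∀ r ∈ Set.Ioc (0:ℝ) 1, -u'' r - ((N:ℝ) - 1) / r * u' r = f (u r)) ∧
      (∀ r ∈ Set.Ioc (0:ℝ) 1, derivWithin f (Set.Ici 0) (u r) = Ψ r) := by
  obtain ⟨k, hkN⟩ : ∃ k : ℝ, k = (N : ℝ) - 2 := ⟨_, rfl⟩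
  have hk9 : 9 ≤ k := by
    have : (11 : ℝ) ≤ N := by exact_mod_cast hN
    linarith
  have hNk : (N : ℝ) - 1 = k + 1 := by linarith
  rw [← hkN] at hΨbd
  rw [hNk]
  obtain ⟨a, ha1, hak, haq⟩ := exists_decay_exponent hk9
  -- Emden–Fowler variable `t = -log r`, with the potential extended by a constant to `t < 0`.
  let φ : ℝ → ℝ := fun t => Real.exp (-max t 0)
  have hφ (t) : φ t ∈ Ioc (0 : ℝ) 1 :=
    ⟨Real.exp_pos _, Real.exp_le_one_iff.2 (by simp)⟩
  have hφc : Continuous φ := by fun_prop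
  let P : ℝ → ℝ := fun t => Ψ (φ t)
  have hPc : Continuous P := hΨc.comp_continuous hφc hφ
  have hPmono : Monotone P := fun s t hst => hΨmono (hφ t) (hφ s) <|
    Real.exp_le_exp.2 (neg_le_neg (max_le_max_right 0 hst))
  let q : ℝ → ℝ := fun t => φ t ^ 2 * P t - (k + 1)
  have hqc : Continuous q := by fun_prop
  have hP1 (t) : 2 * k ≤ φ t ^ 2 * P t := by
    have h := (hΨbd _ (hφ t)).1
    rw [div_le_iff₀ (pow_pos (hφ t).1 2)] at h
    linarith
  have hP2 (t) : φ t ^ 2 * P t ≤ k ^ 2 / 4 := by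
    have h := (hΨbd _ (hφ t)).2
    rw [le_div_iff₀ (by have := (hφ t).1; positivity)] at h
    linarith
  have hP_ge (t) : 2 * k ≤ P t := by
    have h0 : 0 < P t := pos_of_mul_pos_right (by linarith [hP1 t]) (sq_nonneg (φ t))
    have h1 : φ t ^ 2 ≤ 1 := pow_le_one₀ (hφ t).1.le (hφ t).2
    nlinarith [hP1 t]
  have hP_exp (t) (ht : 0 ≤ t) : t ≤ P t := by
    have h := hP1 t
    have h0 : 0 < P t := by linarith [hP_ge t]
    have h1 : φ t * Real.exp t = 1 := by
      simp only [φ, max_eq_left ht]; rw [← Real.exp_add]; simp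
    have h2 := Real.add_one_le_exp t
    have h3 := hφ t
    have h4 : φ t ^ 2 ≤ φ t := by nlinarith [h3.1, h3.2]
    have h5 : φ t * P t ≥ 1 := by nlinarith
    have h6 : P t = Real.exp t * (φ t * P t) := by linear_combination (-P t) * h1
    nlinarith [Real.exp_pos t]
  obtain ⟨y, hy, hy'⟩ := exists_riccati_solution (q := q) ha1 hak hqc
    (fun t => by simp only [q]; linarith [hP1 t])
    (fun t => by simp only [q]; linarith [hP2 t])
  have hyc : Continuous y := continuous_iff_continuousAt.2 fun t => (hy' t).continuousAt
  let E : ℝ → ℝ := fun t => Real.exp (∫ s in (0 : ℝ)..t, (y s - 1))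
  have hE (t) : HasDerivAt E ((y t - 1) * E t) t :=
    (hasDerivAt_integral_of_continuous (hyc.sub continuous_const) t).exp.congr_deriv
      (mul_comm _ _)
  have hEpos (t) : 0 < E t := Real.exp_pos _
  have hEc : Continuous E := continuous_iff_continuousAt.2 fun t => (hE t).continuousAt
  have hE1 (t) (ht : 0 ≤ t) : 1 ≤ E t := Real.one_le_exp <|
    intervalIntegral.integral_nonneg ht fun s _ => by linarith [(hy s).1]
  have hE2 (t) (ht : 0 ≤ t) : E t ≤ Real.exp ((a - 1) * t) := by
    refine Real.exp_le_exp.2 ?_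
    calc ∫ s in (0 : ℝ)..t, (y s - 1) ≤ ∫ s in (0 : ℝ)..t, (a - 1) :=
          intervalIntegral.integral_mono_on ht
            ((hyc.sub continuous_const).intervalIntegrable _ _)
            (continuous_const.intervalIntegrable _ _) fun s _ => by linarith [(hy s).2]
      _ = (a - 1) * t := by simp; ring
  let z : ℝ → ℝ := fun t => ∫ s in (0 : ℝ)..t, max (E s) 1
  have hz (t) : HasDerivAt z (max (E t) 1) t :=
    hasDerivAt_integral_of_continuous (hEc.max continuous_const) t
  obtain ⟨ζ, hζz, hζ⟩ := exists_inverse_of_one_le_deriv hz fun t => le_max_right _ _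
  have hz0 : z 0 = 0 := by simp [z]
  have hζ0 : ζ 0 = 0 := by rw [← hz0, hζz, hz0]
  have hζnn {x : ℝ} (hx : 0 ≤ x) : 0 ≤ ζ x := hζ0 ▸ ζ.monotone hx
  have hz_ge (t) (ht : 0 ≤ t) : t ≤ z t := by
    have := mul_sub_le_image_sub_of_le_deriv (fun t => (hz t).differentiableAt)
      (fun t => by rw [(hz t).deriv]; exact le_max_right _ _) ht
    linarith
  have hz_le (t) (ht : 0 ≤ t) : z t ≤ Real.exp (a * t) := by
    have hB (x : ℝ) : HasDerivAt (fun x => Real.exp (a * x)) (Real.exp (a * x) * a) x := by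
      simpa using ((hasDerivAt_id x).const_mul a).exp
    refine image_le_of_deriv_right_le_deriv_boundary (a := 0) (b := t)
      (fun x _ => (hz x).continuousAt.continuousWithinAt)
      (fun x _ => (hz x).hasDerivWithinAt) (by simp [hz0])
      (fun x _ => (hB x).continuousAt.continuousWithinAt)
      (fun x _ => (hB x).hasDerivWithinAt) (fun x hx => ?_) (right_mem_Icc.2 ht)
    rw [max_eq_left (hE1 x hx.1)]
    have h1 : Real.exp ((a - 1) * x) ≤ Real.exp (a * x) :=
      Real.exp_le_exp.2 (by nlinarith [hx.1])
    nlinarith [hE2 x hx.1, Real.exp_pos (a * x)]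
  let G : ℝ → ℝ := fun t => (k + 1 - y t) * (E t * Real.exp (2 * t))
  have hG (t) : HasDerivAt G ((q t + k + 1) * (E t * Real.exp (2 * t))) t := by
    have hexp : HasDerivAt (fun x => Real.exp (2 * x)) (Real.exp (2 * t) * 2) t := by
      simpa using ((hasDerivAt_id t).const_mul 2).exp
    refine (((hy' t).const_sub (k + 1)).mul ((hE t).mul hexp)).congr_deriv ?_
    simp only [Pi.mul_apply]
    ring
  let f : ℝ → ℝ := fun x => G (ζ x)
  have hf (x) (hx : 0 ≤ x) : HasDerivAt f (P (ζ x)) x := by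
    refine ((hG (ζ x)).comp x (hζ x)).congr_deriv ?_
    have ht := hζnn hx
    rw [max_eq_left (hE1 _ ht)]
    have h1 : φ (ζ x) ^ 2 * Real.exp (2 * ζ x) = 1 := by
      simp only [φ, max_eq_left ht]; rw [← Real.exp_nat_mul, ← Real.exp_add]; simp
    have h2 := (hEpos (ζ x)).ne'
    field_simp
    simp only [q]
    linear_combination P (ζ x) * h1
  have hstar : StarCond f := by
    refine starCond_of_hasDerivAt hf (hPc.comp ζ.continuous).continuousOn
      ((hPmono.comp ζ.monotone).monotoneOn _) (fun x _ => by linarith [hP_ge (ζ x)]) ?_ ?_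
    · refine Tendsto.comp (g := P) ?_ ζ.tendsto_atTop
      exact tendsto_atTop_mono' _ ((eventually_ge_atTop 0).mono hP_exp) tendsto_id
    · have := (hy 0).2
      have := hEpos 0
      simp only [f, G, hζ0]
      have : 0 < k + 1 - y 0 := by linarith
      positivity
  have hlog {r : ℝ} (hr : r ∈ Ioc (0 : ℝ) 1) : 0 ≤ -Real.log r := by
    linarith [Real.log_nonpos hr.1.le hr.2]
  have hφlog {r : ℝ} (hr : r ∈ Ioc (0 : ℝ) 1) : φ (-Real.log r) = r := by
    simp only [φ, max_eq_left (hlog hr), neg_neg, Real.exp_log hr.1]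
  have hdlog {r : ℝ} (hr : r ∈ Ioc (0 : ℝ) 1) : HasDerivAt (fun r => -Real.log r) (-r⁻¹) r :=
    (Real.hasDerivAt_log hr.1.ne').neg
  let u : ℝ → ℝ := fun r => z (-Real.log r)
  let u' : ℝ → ℝ := fun r => -(E (-Real.log r) * r⁻¹)
  let u'' : ℝ → ℝ := fun r => y (-Real.log r) * E (-Real.log r) * (r ^ 2)⁻¹
  let u''' : ℝ → ℝ := fun r =>
    (q (-Real.log r) - (k + 1) * y (-Real.log r)) * E (-Real.log r) * (r ^ 3)⁻¹
  have hdE {r : ℝ} (hr : r ∈ Ioc (0 : ℝ) 1) := (hE (-Real.log r)).comp r (hdlog hr)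
  have hdy {r : ℝ} (hr : r ∈ Ioc (0 : ℝ) 1) := (hy' (-Real.log r)).comp r (hdlog hr)
  have hd1 : ∀ r ∈ Ioc (0 : ℝ) 1, HasDerivAt u (u' r) r := fun r hr => by
    refine ((hz (-Real.log r)).comp r (hdlog hr)).congr_deriv ?_
    simp [u', max_eq_left (hE1 _ (hlog hr))]
  have hd2 : ∀ r ∈ Ioc (0 : ℝ) 1, HasDerivAt u' (u'' r) r := fun r hr => by
    have hr0 := hr.1.ne'
    refine ((hdE hr).mul (hasDerivAt_inv hr0)).neg.congr_deriv ?_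
    simp only [u'', Function.comp_apply]
    field_simp
    ring
  have hd3 : ∀ r ∈ Ioc (0 : ℝ) 1, HasDerivAt u'' (u''' r) r := fun r hr => by
    have hr0 := hr.1.ne'
    refine (((hdy hr).mul (hdE hr)).mul
      ((hasDerivAt_pow 2 r).inv (pow_ne_zero 2 hr0))).congr_deriv ?_
    simp only [u''', Function.comp_apply, Pi.mul_apply, Pi.inv_apply]
    field_simp
    ring
  have hlogc : ContinuousOn (fun r => -Real.log r) (Ioc 0 1) := fun r hr =>
    (hdlog hr).continuousAt.continuousWithinAt
  have hc3 : ContinuousOn u''' (Ioc 0 1) := by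
    refine ContinuousOn.mul ?_ ((continuousOn_id.pow 3).inv₀ fun r hr => pow_ne_zero 3 hr.1.ne')
    exact Continuous.comp_continuousOn (g := fun t => (q t - (k + 1) * y t) * E t)
      (by fun_prop) hlogc
  have hw1 : ∀ r ∈ Ioc (0 : ℝ) 1, HasDerivWithinAt u (u' r) (Ioc 0 1) r :=
    fun r hr => (hd1 r hr).hasDerivWithinAt
  have hw2 : ∀ r ∈ Ioc (0 : ℝ) 1, HasDerivWithinAt u' (u'' r) (Ioc 0 1) r :=
    fun r hr => (hd2 r hr).hasDerivWithinAt
  have hw3 : ∀ r ∈ Ioc (0 : ℝ) 1, HasDerivWithinAt u'' (u''' r) (Ioc 0 1) r :=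
    fun r hr => (hd3 r hr).hasDerivWithinAt
  have hfu (r : ℝ) : f (u r) = G (-Real.log r) := by simp only [f, u, hζz]
  have hunn {r : ℝ} (hr : r ∈ Ioc (0 : ℝ) 1) : 0 ≤ u r := (hlog hr).trans (hz_ge _ (hlog hr))
  refine ⟨f, u, u', u'', u''', hstar,
    contDiffOn_three_of_hasDerivWithinAt (uniqueDiffOn_Ioc 0 1) hw1 hw2 hw3 hc3, hw1, hw2, hw3,
    hc3, by simp [u, hz0], fun r hr => ?_, ?_, ?_, fun r hr => ?_, fun r hr => ?_⟩
  · have := hEpos (-Real.log r)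
    have := hr.1
    simp only [u', neg_lt_zero]
    positivity
  · have hlim : Tendsto (fun r => -Real.log r) (nhdsWithin 0 (Ioi 0)) atTop :=
      tendsto_neg_atBot_atTop.comp Real.tendsto_log_nhdsGT_zero
    refine Tendsto.comp (g := z) ?_ hlim
    exact tendsto_atTop_mono' _ ((eventually_ge_atTop 0).mono hz_ge) tendsto_id
  · rw [intervalIntegrable_iff_integrableOn_Ioc_of_le zero_le_one]
    have hcont : ContinuousOn (fun r => r ^ (N - 1) * (u r ^ 2 + u' r ^ 2)) (Ioc 0 1) := by
      have h1 : ContinuousOn u (Ioc 0 1) := fun r hr => (hw1 r hr).continuousWithinAt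
      have h2 : ContinuousOn u' (Ioc 0 1) := fun r hr => (hw2 r hr).continuousWithinAt
      fun_prop
    refine Integrable.of_bound (hcont.aestronglyMeasurable measurableSet_Ioc) 2 ?_
    refine (ae_restrict_iff' measurableSet_Ioc).2 (Eventually.of_forall fun r hr => ?_)
    have hr0 := hr.1
    obtain ⟨t, ht, rfl⟩ : ∃ t, 0 ≤ t ∧ r = Real.exp (-t) :=
      ⟨-Real.log r, hlog hr, by simp [Real.exp_log hr0]⟩
    have hu0 := hunn hr
    have hu : u (Real.exp (-t)) ≤ Real.exp (a * t) := by
      simpa [u] using hz_le t ht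
    have hu1 : |u' (Real.exp (-t))| ≤ Real.exp (a * t) := by
      have h1 : Real.exp (a * t) = Real.exp ((a - 1) * t) * Real.exp t := by
        rw [← Real.exp_add]; ring_nf
      simp only [u', Real.log_exp, neg_neg, abs_neg, ← Real.exp_neg]
      rw [abs_of_pos (mul_pos (hEpos t) (Real.exp_pos t)), h1]
      gcongr
      exact hE2 t ht
    have hpow : Real.exp (-t) ^ (N - 1) * Real.exp (a * t) ^ 2 ≤ 1 := by
      rw [← Real.exp_nat_mul, ← Real.exp_nat_mul, ← Real.exp_add, Real.exp_le_one_iff,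
        Nat.cast_sub (by omega), Nat.cast_one, hNk]
      push_cast
      nlinarith
    have hsq1 : u (Real.exp (-t)) ^ 2 ≤ Real.exp (a * t) ^ 2 := by gcongr
    have hsq2 : u' (Real.exp (-t)) ^ 2 ≤ Real.exp (a * t) ^ 2 := by
      rw [← sq_abs]; gcongr
    rw [Real.norm_of_nonneg (by positivity)]
    nlinarith [pow_pos hr0 (N - 1)]
  · have hr0 := hr.1.ne'
    have h1 : Real.exp (2 * -Real.log r) = (r ^ 2)⁻¹ := by
      rw [mul_neg, Real.exp_neg, ← Real.log_rpow hr.1, Real.exp_log (by have := hr.1; positivity)]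
      norm_cast
    rw [hfu]
    simp only [u', u'', G, h1]
    field_simp
    ring
  · have h := hf (u r) (hunn hr)
    rw [h.hasDerivWithinAt.derivWithin (uniqueDiffOn_Ici 0 _ (hunn hr))]
    simp only [u, hζz, P, hφlog hr]
end

section
/- Let N ≥ 11 be an integer and let Ψ : (0,1] → ℝ be a continuous nonincreasing function satisfying 2(N−2)/r² ≤ Ψ(r) ≤ (N−2)²/(4r²) for every r ∈ (0,1]. Let f, g : [0,∞) → ℝ be C¹ functions satisfying condition (★), and let u, v : (0,1] → ℝ be C³ functions such that for w = u (with nonlinearity f) and w = v (with nonlinearity g): w(1) = 0, w'(r) < 0 for all r ∈ (0,1], lim_{r→0⁺} w(r) = +∞, ∫₀¹ r^{N−1}(w'(r)² + w''(r)²) dr < ∞, −w''(r) − ((N−1)/r)·w'(r) equals f(u(r)) resp. g(v(r)) for all r ∈ (0,1], and f'(u(r)) = Ψ(r) = g'(v(r)) for all r ∈ (0,1]. Then there exists α > 0 such that v(r) = α·u(r) for every r ∈ (0,1] and g(s) = α·f(s/α) for every s ∈ [0,∞). -/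
open MeasureTheory Filter Set

theorem eq_at_one_of_hasDerivWithinAt_zero {F : ℝ → ℝ}
    (hF : ∀ r ∈ Set.Ioc (0:ℝ) 1, HasDerivWithinAt F 0 (Set.Ioc 0 1) r)
    {r : ℝ} (hr : r ∈ Set.Ioc (0:ℝ) 1) : F r = F 1 := by
  have h := Convex.norm_image_sub_le_of_norm_hasDerivWithin_le (C := 0) hF
    (fun x _ => by simp) (convex_Ioc 0 1) (right_mem_Ioc.2 one_pos) hr
  rw [zero_mul] at h
  exact sub_eq_zero.1 (norm_le_zero_iff.1 h)

theorem nonneg_of_deriv_neg {u u' : ℝ → ℝ}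
    (hu : ∀ r ∈ Set.Ioc (0:ℝ) 1, HasDerivWithinAt u (u' r) (Set.Ioc 0 1) r)
    (hneg : ∀ r ∈ Set.Ioc (0:ℝ) 1, u' r < 0) (hu1 : u 1 = 0)
    {r : ℝ} (hr : r ∈ Set.Ioc (0:ℝ) 1) : 0 ≤ u r := by
  have hanti : AntitoneOn u (Set.Ioc 0 1) := by
    refine antitoneOn_of_hasDerivWithinAt_nonpos (f' := u') (convex_Ioc 0 1)
      (fun x hx => (hu x hx).continuousWithinAt) (fun x hx => ?_) (fun x hx => ?_)
    · exact (hu x (interior_subset hx)).mono interior_subset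
    · exact (hneg x (interior_subset hx)).le
  rw [← hu1]
  exact hanti hr (right_mem_Ioc.2 one_pos) hr.2

/-- Differentiating the radial equation `-Δu = f(u)` gives a linear equation for `u'`. -/
theorem linearized_radial_equation {a : ℝ} {f Ψ u u' u'' u''' : ℝ → ℝ}
    (hf : DifferentiableOn ℝ f (Set.Ici 0))
    (hud1 : ∀ r ∈ Set.Ioc (0:ℝ) 1, HasDerivWithinAt u (u' r) (Set.Ioc 0 1) r)
    (hud2 : ∀ r ∈ Set.Ioc (0:ℝ) 1, HasDerivWithinAt u' (u'' r) (Set.Ioc 0 1) r)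
    (hud3 : ∀ r ∈ Set.Ioc (0:ℝ) 1, HasDerivWithinAt u'' (u''' r) (Set.Ioc 0 1) r)
    (hpos : ∀ r ∈ Set.Ioc (0:ℝ) 1, 0 ≤ u r)
    (hpde : ∀ r ∈ Set.Ioc (0:ℝ) 1, -u'' r - a / r * u' r = f (u r))
    (hΨ : ∀ r ∈ Set.Ioc (0:ℝ) 1, derivWithin f (Set.Ici 0) (u r) = Ψ r)
    {r : ℝ} (hr : r ∈ Set.Ioc (0:ℝ) 1) :
    u''' r = -(a / r) * u'' r + (a / r ^ 2 - Ψ r) * u' r := by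
  have hr0 : r ≠ 0 := hr.1.ne'
  have hcomp : HasDerivWithinAt (fun x => f (u x)) (Ψ r * u' r) (Set.Ioc 0 1) r := by
    have h := (hf (u r) (hpos r hr)).hasDerivWithinAt
    rw [hΨ r hr] at h
    exact h.comp r (hud1 r hr) hpos
  have hlhs : HasDerivWithinAt (fun x => -u'' x - a / x * u' x)
      (-u''' r - (-a / r ^ 2 * u' r + a / r * u'' r)) (Set.Ioc 0 1) r := by
    have hdiv : HasDerivWithinAt (fun x : ℝ => a / x) (-a / r ^ 2) (Set.Ioc 0 1) r := by
      have h := ((hasDerivAt_const r a).div (hasDerivAt_id r) hr0).hasDerivWithinAt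
        (s := Set.Ioc (0:ℝ) 1)
      exact h.congr_deriv (by simp)
    exact (hud3 r hr).neg.sub (hdiv.mul (hud2 r hr))
  have hcongr := hlhs.congr_of_mem (fun x hx => (hpde x hx).symm) hr
  have huniq : UniqueDiffWithinAt ℝ (Set.Ioc (0:ℝ) 1) r := uniqueDiffOn_Ioc 0 1 r hr
  have heq := huniq.eq_deriv _ hcomp hcongr
  have hneg : -a / r ^ 2 = -(a / r ^ 2) := neg_div _ _
  rw [hneg] at heq
  linarith

/-- A constant weighted Wronskian of two functions of finite energy vanishes: by a Hardy type
estimate, a nonzero value would make `1 / r` integrable at the origin. -/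
theorem wronskian_const_eq_zero {n : ℕ} (hn : 1 ≤ n) {w w' z z' : ℝ → ℝ} {c : ℝ}
    (hw : ∀ r ∈ Set.Ioc (0:ℝ) 1, HasDerivWithinAt w (w' r) (Set.Ioc 0 1) r)
    (hz : ∀ r ∈ Set.Ioc (0:ℝ) 1, HasDerivWithinAt z (z' r) (Set.Ioc 0 1) r)
    (hw' : ContinuousOn w' (Set.Ioc 0 1)) (hz' : ContinuousOn z' (Set.Ioc 0 1))
    (hwint : IntervalIntegrable (fun r => r ^ (n + 2) * (w r ^ 2 + w' r ^ 2)) volume 0 1)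
    (hzint : IntervalIntegrable (fun r => r ^ (n + 2) * (z r ^ 2 + z' r ^ 2)) volume 0 1)
    (hc : ∀ r ∈ Set.Ioc (0:ℝ) 1, r ^ (n + 2) * (w' r * z r - w r * z' r) = c) : c = 0 := by
  by_contra hc0
  set G : ℝ → ℝ := fun r => r ^ (n + 2) * (w r ^ 2 + w' r ^ 2) + r ^ (n + 2) * (z r ^ 2 + z' r ^ 2)
    with hG
  set P : ℝ → ℝ := fun r => ∫ x in (0:ℝ)..r, G x with hP
  set F : ℝ → ℝ := fun r => r ^ (n + 1) * (w r ^ 2 + z r ^ 2) with hF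
  have hGint : IntervalIntegrable G volume 0 1 := hwint.add hzint
  have hwc : ContinuousOn w (Set.Ioc 0 1) := fun x hx => (hw x hx).continuousWithinAt
  have hzc : ContinuousOn z (Set.Ioc 0 1) := fun x hx => (hz x hx).continuousWithinAt
  have hGc : ContinuousOn G (Set.Ioc 0 1) := by rw [hG]; fun_prop
  have hFc : ContinuousOn F (Set.Ioc 0 1) := by rw [hF]; fun_prop
  have hG0 : ∀ r ∈ Set.Ioc (0:ℝ) 1, 0 ≤ G r := fun r hr => by
    have := hr.1
    simp only [hG]
    positivity
  have hPc : ContinuousOn P (Set.Ioc 0 1) := by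
    have h := intervalIntegral.continuousOn_primitive_interval'
      hGint left_mem_uIcc
    refine h.mono (fun x hx => ?_)
    rw [uIcc_of_le zero_le_one]
    exact ⟨hx.1.le, hx.2⟩
  have hP' : ∀ r ∈ Set.Ioo (0:ℝ) 1, HasDerivAt P (G r) r := fun r hr => by
    have hGo : ContinuousOn G (Set.Ioo 0 1) := hGc.mono Ioo_subset_Ioc_self
    refine intervalIntegral.integral_hasDerivAt_right ?_
      (hGo.stronglyMeasurableAtFilter isOpen_Ioo r hr)
      (hGo.continuousAt (isOpen_Ioo.mem_nhds hr))
    refine hGint.mono_set ?_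
    rw [uIcc_of_le zero_le_one, uIcc_of_le hr.1.le]
    exact Icc_subset_Icc_right hr.2.le
  have hP0 : ∀ r ∈ Set.Ioc (0:ℝ) 1, 0 ≤ P r := fun r hr => by
    simp only [hP]
    rw [intervalIntegral.integral_of_le hr.1.le]
    exact setIntegral_nonneg measurableSet_Ioc
      (fun x hx => hG0 x ⟨hx.1, hx.2.trans hr.2⟩)
  have hF0 : ∀ r ∈ Set.Ioc (0:ℝ) 1, 0 ≤ F r := fun r hr => by
    have := hr.1
    simp only [hF]
    positivity
  have hanti : AntitoneOn (fun r => 2 * |c| * Real.log r - F r - 2 * P r) (Set.Ioc 0 1) := by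
    refine antitoneOn_of_hasDerivWithinAt_nonpos (convex_Ioc 0 1)
      (f' := fun r => 2 * |c| * r⁻¹ - (((n + 1 : ℕ) : ℝ) * r ^ n * (w r ^ 2 + z r ^ 2)
        + r ^ (n + 1) * (2 * w r * w' r + 2 * z r * z' r)) - 2 * G r) ?_ ?_ ?_
    · have hlog : ContinuousOn Real.log (Set.Ioc (0:ℝ) 1) :=
        Real.continuousOn_log.mono (fun x hx => hx.1.ne')
      fun_prop
    · rw [interior_Ioc]
      intro r hr
      have hmem : Set.Ioc (0:ℝ) 1 ∈ nhds r := Ioc_mem_nhds hr.1 hr.2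
      have hwr := (hw r ⟨hr.1, hr.2.le⟩).hasDerivAt hmem
      have hzr := (hz r ⟨hr.1, hr.2.le⟩).hasDerivAt hmem
      have hFr : HasDerivAt F (((n + 1 : ℕ) : ℝ) * r ^ n * (w r ^ 2 + z r ^ 2)
          + r ^ (n + 1) * (2 * w r * w' r + 2 * z r * z' r)) r := by
        have h := (hasDerivAt_pow (n + 1) r).mul ((hwr.pow 2).add (hzr.pow 2))
        exact h.congr_deriv (by simp)
      exact ((((Real.hasDerivAt_log hr.1.ne').const_mul (2 * |c|)).sub hFr).sub
        ((hP' r hr).const_mul 2)).hasDerivWithinAt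
    · rw [interior_Ioc]
      intro r hr
      have hr0 : 0 < r := hr.1
      have hcr := hc r ⟨hr.1, hr.2.le⟩
      have habs : |c| * r⁻¹ = r ^ (n + 1) * |w' r * z r - w r * z' r| := by
        rw [← hcr, abs_mul, abs_of_pos (by positivity : 0 < r ^ (n + 2))]
        field_simp
        ring
      have hn' : (1:ℝ) ≤ n := by exact_mod_cast hn
      have hrn : 0 < r ^ n := by positivity
      have hyoung : 2 * r * |w' r * z r - w r * z' r| ≤
          (w r ^ 2 + z r ^ 2) + r ^ 2 * (w' r ^ 2 + z' r ^ 2) := by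
        rcases abs_cases (w' r * z r - w r * z' r) with h | h <;> rw [h.1] <;>
        nlinarith [sq_nonneg (r * w' r - z r), sq_nonneg (r * w' r + z r),
          sq_nonneg (r * z' r - w r), sq_nonneg (r * z' r + w r)]
      have hkey : 2 * r * |w' r * z r - w r * z' r| ≤ (n + 1) * (w r ^ 2 + z r ^ 2)
          + r * (2 * w r * w' r + 2 * z r * z' r)
          + 2 * (r ^ 2 * (w r ^ 2 + w' r ^ 2 + z r ^ 2 + z' r ^ 2)) := by
        nlinarith [sq_nonneg (r * w' r + w r), sq_nonneg (r * z' r + z r),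
          mul_le_mul_of_nonneg_right hn' (by positivity : 0 ≤ w r ^ 2 + z r ^ 2),
          sq_nonneg (r * w r), sq_nonneg (r * z r)]
      have hmul := mul_le_mul_of_nonneg_left hkey hrn.le
      simp only [hG]
      rw [mul_assoc, habs]
      push_cast
      ring_nf at hmul ⊢
      linarith
  have hbound : ∀ r ∈ Set.Ioc (0:ℝ) 1, -(F 1 + 2 * P 1) ≤ 2 * |c| * Real.log r := fun r hr => by
    have h := hanti hr (right_mem_Ioc.2 one_pos) hr.2
    simp only [Real.log_one, mul_zero, zero_sub] at h
    linarith [hF0 r hr, hP0 r hr]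
  have hcpos : 0 < |c| := abs_pos.2 hc0
  have hlim : Tendsto (fun r => 2 * |c| * Real.log r) (nhdsWithin 0 (Set.Ioi 0)) atBot :=
    Real.tendsto_log_nhdsGT_zero.const_mul_atBot (by positivity)
  obtain ⟨r, hr, hr'⟩ := ((hlim.eventually_lt_atBot (-(F 1 + 2 * P 1))).and
    (Ioc_mem_nhdsGT one_pos)).exists
  exact absurd (hbound r hr') (not_le.2 hr)

/-- Abel's identity for `w'' + (a / r) w' = q w`. -/
theorem weighted_wronskian_const {k : ℕ} {q w w' w'' z z' z'' : ℝ → ℝ}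
    (hw : ∀ r ∈ Set.Ioc (0:ℝ) 1, HasDerivWithinAt w (w' r) (Set.Ioc 0 1) r)
    (hz : ∀ r ∈ Set.Ioc (0:ℝ) 1, HasDerivWithinAt z (z' r) (Set.Ioc 0 1) r)
    (hw' : ∀ r ∈ Set.Ioc (0:ℝ) 1, HasDerivWithinAt w' (w'' r) (Set.Ioc 0 1) r)
    (hz' : ∀ r ∈ Set.Ioc (0:ℝ) 1, HasDerivWithinAt z' (z'' r) (Set.Ioc 0 1) r)
    (hweq : ∀ r ∈ Set.Ioc (0:ℝ) 1, w'' r = -(((k + 1 : ℕ) : ℝ) / r) * w' r + q r * w r)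
    (hzeq : ∀ r ∈ Set.Ioc (0:ℝ) 1, z'' r = -(((k + 1 : ℕ) : ℝ) / r) * z' r + q r * z r)
    {r : ℝ} (hr : r ∈ Set.Ioc (0:ℝ) 1) :
    r ^ (k + 1) * (w' r * z r - w r * z' r) = w' 1 * z 1 - w 1 * z' 1 := by
  have h := eq_at_one_of_hasDerivWithinAt_zero
    (F := fun r => r ^ (k + 1) * (w' r * z r - w r * z' r)) (fun x hx => ?_) hr
  · simpa using h
  · have hx0 : x ≠ 0 := hx.1.ne'
    have h := ((hasDerivAt_pow (k + 1) x).hasDerivWithinAt (s := Set.Ioc (0:ℝ) 1)).mul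
      (((hw' x hx).mul (hz x hx)).sub ((hw x hx).mul (hz' x hx)))
    refine h.congr_deriv ?_
    simp only [hweq x hx, hzeq x hx, Nat.add_sub_cancel, Pi.sub_apply, Pi.mul_apply]
    field_simp
    ring

theorem exists_eq_of_tendsto_atTop {u : ℝ → ℝ} (huc : ContinuousOn u (Set.Ioc 0 1))
    (hu1 : u 1 = 0) (hulim : Tendsto u (nhdsWithin 0 (Set.Ioi 0)) atTop) {s : ℝ} (hs : 0 ≤ s) :
    ∃ r ∈ Set.Ioc (0:ℝ) 1, u r = s := by
  obtain ⟨r₀, hr₀, hmem⟩ := ((hulim.eventually_ge_atTop s).and (Ioc_mem_nhdsGT one_pos)).exists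
  have hsub : Set.Icc r₀ 1 ⊆ Set.Ioc (0:ℝ) 1 := fun x hx => ⟨hmem.1.trans_le hx.1, hx.2⟩
  obtain ⟨r, hr, hrs⟩ := intermediate_value_Icc' hmem.2 (huc.mono hsub)
    (show s ∈ Set.Icc (u 1) (u r₀) from ⟨hu1 ▸ hs, hr₀⟩)
  exact ⟨r, hsub hr, hrs⟩

theorem stmt16 (N : ℕ) (hN : 11 ≤ N) (Ψ : ℝ → ℝ)
    (hΨc : ContinuousOn Ψ (Set.Ioc 0 1))
    (hΨmono : AntitoneOn Ψ (Set.Ioc 0 1))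
    (hΨbd : ∀ r ∈ Set.Ioc (0:ℝ) 1,
      2 * ((N:ℝ) - 2) / r ^ 2 ≤ Ψ r ∧ Ψ r ≤ ((N:ℝ) - 2) ^ 2 / (4 * r ^ 2))
    (f g : ℝ → ℝ) (hf : StarCond f) (hg : StarCond g)
    (u u' u'' u''' v v' v'' v''' : ℝ → ℝ)
    (hud1 : ∀ r ∈ Set.Ioc (0:ℝ) 1, HasDerivWithinAt u (u' r) (Set.Ioc 0 1) r)
    (hud2 : ∀ r ∈ Set.Ioc (0:ℝ) 1, HasDerivWithinAt u' (u'' r) (Set.Ioc 0 1) r)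
    (hud3 : ∀ r ∈ Set.Ioc (0:ℝ) 1, HasDerivWithinAt u'' (u''' r) (Set.Ioc 0 1) r)
    (hud4 : ContinuousOn u''' (Set.Ioc 0 1))
    (hvd1 : ∀ r ∈ Set.Ioc (0:ℝ) 1, HasDerivWithinAt v (v' r) (Set.Ioc 0 1) r)
    (hvd2 : ∀ r ∈ Set.Ioc (0:ℝ) 1, HasDerivWithinAt v' (v'' r) (Set.Ioc 0 1) r)
    (hvd3 : ∀ r ∈ Set.Ioc (0:ℝ) 1, HasDerivWithinAt v'' (v''' r) (Set.Ioc 0 1) r)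
    (hvd4 : ContinuousOn v''' (Set.Ioc 0 1))
    (hu1 : u 1 = 0) (hv1 : v 1 = 0)
    (hu'neg : ∀ r ∈ Set.Ioc (0:ℝ) 1, u' r < 0)
    (hv'neg : ∀ r ∈ Set.Ioc (0:ℝ) 1, v' r < 0)
    (hulim : Tendsto u (nhdsWithin 0 (Set.Ioi 0)) atTop)
    (hvlim : Tendsto v (nhdsWithin 0 (Set.Ioi 0)) atTop)
    (huint : IntervalIntegrable (fun r => r ^ (N - 1) * (u' r ^ 2 + u'' r ^ 2)) volume 0 1)
    (hvint : IntervalIntegrable (fun r => r ^ (N - 1) * (v' r ^ 2 + v'' r ^ 2)) volume 0 1)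
    (hupde : ∀ r ∈ Set.Ioc (0:ℝ) 1, -u'' r - ((N:ℝ) - 1) / r * u' r = f (u r))
    (hvpde : ∀ r ∈ Set.Ioc (0:ℝ) 1, -v'' r - ((N:ℝ) - 1) / r * v' r = g (v r))
    (huΨ : ∀ r ∈ Set.Ioc (0:ℝ) 1, derivWithin f (Set.Ici 0) (u r) = Ψ r)
    (hvΨ : ∀ r ∈ Set.Ioc (0:ℝ) 1, derivWithin g (Set.Ici 0) (v r) = Ψ r) :
    ∃ α : ℝ, 0 < α ∧ (∀ r ∈ Set.Ioc (0:ℝ) 1, v r = α * u r) ∧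
      ∀ s : ℝ, 0 ≤ s → g s = α * f (s / α) := by
  obtain ⟨n, rfl⟩ : ∃ n, N = n + 3 := ⟨N - 3, by omega⟩
  have hexp : n + 3 - 1 = n + 2 := rfl
  rw [hexp] at huint hvint
  have hcast : (((n + 3 : ℕ) : ℝ) - 1) = ((n + 1 + 1 : ℕ) : ℝ) := by push_cast; ring
  simp only [hcast] at hupde hvpde
  have hulin := fun r hr => linearized_radial_equation (r := r) (hf.1.differentiableOn one_ne_zero)
    hud1 hud2 hud3 (fun r hr => nonneg_of_deriv_neg hud1 hu'neg hu1 hr) hupde huΨ hr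
  have hvlin := fun r hr => linearized_radial_equation (r := r) (hg.1.differentiableOn one_ne_zero)
    hvd1 hvd2 hvd3 (fun r hr => nonneg_of_deriv_neg hvd1 hv'neg hv1 hr) hvpde hvΨ hr
  have hwr := fun r hr => weighted_wronskian_const (r := r) hud2 hvd2 hud3 hvd3 hulin hvlin hr
  have hc0 := wronskian_const_eq_zero (n := n) (by omega) hud2 hvd2
    (fun x hx => (hud3 x hx).continuousWithinAt) (fun x hx => (hvd3 x hx).continuousWithinAt)
    huint hvint hwr
  have h1 : (1:ℝ) ∈ Set.Ioc (0:ℝ) 1 := right_mem_Ioc.2 one_pos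
  set α := v' 1 / u' 1 with hα
  have hratio : ∀ r ∈ Set.Ioc (0:ℝ) 1, v' r = α * u' r := fun r hr => by
    have hzero : ∀ x ∈ Set.Ioc (0:ℝ) 1,
        HasDerivWithinAt (fun x => v' x / u' x) 0 (Set.Ioc 0 1) x := fun x hx => by
      refine ((hvd2 x hx).div (hud2 x hx) (hu'neg x hx).ne).congr_deriv ?_
      have h := hwr x hx
      rw [hc0] at h
      have hw0 := (mul_eq_zero.1 h).resolve_left (pow_ne_zero _ hx.1.ne')
      rw [div_eq_zero_iff]
      left
      linarith
    have h := eq_at_one_of_hasDerivWithinAt_zero hzero hr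
    exact (div_eq_iff (hu'neg r hr).ne).1 h
  have hα0 : 0 < α := div_pos_of_neg_of_neg (hv'neg 1 h1) (hu'neg 1 h1)
  have hvu : ∀ r ∈ Set.Ioc (0:ℝ) 1, v r = α * u r := fun r hr => by
    have h := eq_at_one_of_hasDerivWithinAt_zero (F := fun x => v x - α * u x) (fun x hx => by
      exact ((hvd1 x hx).sub ((hud1 x hx).const_mul α)).congr_deriv (by simp [hratio x hx])) hr
    simp only [hu1, hv1, mul_zero, sub_zero] at h
    linarith
  have hratio2 : ∀ r ∈ Set.Ioc (0:ℝ) 1, v'' r = α * u'' r := fun r hr =>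
    (uniqueDiffOn_Ioc (0:ℝ) 1 r hr).eq_deriv _ (hvd2 r hr)
      (((hud2 r hr).const_mul α).congr_of_mem hratio hr)
  refine ⟨α, hα0, hvu, fun s hs => ?_⟩
  obtain ⟨r, hr, hrs⟩ := exists_eq_of_tendsto_atTop
    (fun x hx => (hud1 x hx).continuousWithinAt) hu1 hulim (div_nonneg hs hα0.le)
  have hvs : v r = s := by rw [hvu r hr, hrs]; field_simp
  rw [← hrs, ← hupde r hr, ← hvs, ← hvpde r hr, hratio r hr, hratio2 r hr]
  ring
end

section
/- Let N ≥ 3 be an integer, let Ψ : (0,1] → ℝ be continuous, and let ω : (0,1] → ℝ be a C² function with ω(r) > 0 for all r ∈ (0,1] satisfying ω''(r) + ((N−1)/r)·ω'(r) + (Ψ(r) − (N−1)/r²)·ω(r) = 0 for every r ∈ (0,1], and such that ∫₀¹ ω(t) dt = +∞. Define u(r) := ∫_r¹ ω(t) dt for r ∈ (0,1]. Then u is a strictly decreasing C³ bijection from (0,1] onto [0,∞); there is a well-defined function f : [0,∞) → ℝ given by f(u(r)) = −u''(r) − ((N−1)/r)·u'(r) for r ∈ (0,1]; this f is C¹ on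 [0,∞); and f'(u(r)) = Ψ(r) for every r ∈ (0,1]. -/
open MeasureTheory Filter Set

/-- A strictly monotone map from an order-connected set onto an order-connected set is
continuous. -/
theorem StrictMonoOn.continuousOn_of_ordConnected_image {v : ℝ → ℝ} {s : Set ℝ}
    (hv : StrictMonoOn v s) (hs : s.OrdConnected) (ht : (v '' s).OrdConnected) :
    ContinuousOn v s := by
  rw [continuousOn_iff_continuous_domRestrict]
  exact continuous_subtype_val.comp (hv.orderIso v s).continuous

/-- The inverse of a strictly antitone bijection between order-connected sets is continuous. -/
theorem StrictAntiOn.continuousOn_of_invOn {u v : ℝ → ℝ} {s t : Set ℝ} (hu : StrictAntiOn u s)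
    (huv : BijOn u s t) (hinv : InvOn v u s t) (hs : s.OrdConnected) (ht : t.OrdConnected) :
    ContinuousOn v t := by
  have hv : BijOn v t s := huv.symm hinv.symm
  have hanti : StrictMonoOn (fun y => -v y) t := by
    intro a ha b hb hab
    refine neg_lt_neg ((hu.lt_iff_gt (hv.mapsTo ha) (hv.mapsTo hb)).1 ?_)
    rwa [hinv.2 ha, hinv.2 hb]
  have himage : (fun y => -v y) '' t = Neg.neg ⁻¹' s := by
    rw [← hv.image_eq]
    exact (Set.image_image Neg.neg v t).symm.trans Set.image_neg_eq_neg
  have hconn : ((fun y => -v y) '' t).OrdConnected := by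
    rw [himage]
    exact hs.preimage_anti fun _ _ h => neg_le_neg h
  exact (hanti.continuousOn_of_ordConnected_image ht hconn).neg.congr fun y _ => (neg_neg _).symm

/-- The one-dimensional inverse function rule for derivatives within sets. -/
theorem HasDerivWithinAt.of_invOn {u v : ℝ → ℝ} {s t : Set ℝ} {y u' : ℝ}
    (hu : HasDerivWithinAt u u' s (v y)) (hu' : u' ≠ 0) (hv : ContinuousOn v t)
    (hmaps : MapsTo v t s) (hinv : RightInvOn v u t) (hy : y ∈ t) :
    HasDerivWithinAt v u'⁻¹ t y :=
  HasFDerivWithinAt.of_local_left_inverse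
    (f' := ContinuousLinearEquiv.unitsEquivAut ℝ (Units.mk0 u' hu'))
    ((hv y hy).tendsto_nhdsWithin hmaps) hu hy
    (eventually_mem_nhdsWithin.mono fun _ hx => hinv hx)

theorem contDiffOn_succ_of_hasDerivWithinAt {n : ℕ} {f f' : ℝ → ℝ} {s : Set ℝ}
    (hs : UniqueDiffOn ℝ s) (hf : ∀ x ∈ s, HasDerivWithinAt f (f' x) s x)
    (hf' : ContDiffOn ℝ n f' s) : ContDiffOn ℝ (n + 1) f s :=
  (contDiffOn_succ_iff_derivWithin hs).2
    ⟨fun x hx => (hf x hx).differentiableWithinAt, by simp,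
      hf'.congr fun x hx => (hf x hx).derivWithin (hs x hx)⟩

theorem ContinuousOn.intervalIntegrable_of_mem_Ioc {ω : ℝ → ℝ} (hω : ContinuousOn ω (Ioc 0 1))
    {r : ℝ} (hr : r ∈ Ioc (0 : ℝ) 1) : IntervalIntegrable ω volume r 1 :=
  (hω.mono fun _ ht => ⟨hr.1.trans_le ht.1, ht.2⟩).intervalIntegrable_of_Icc hr.2

/-- The fundamental theorem of calculus for `r ↦ ∫ t in r..1, ω t` on `(0, 1]`. -/
theorem hasDerivWithinAt_integral_Ioc {ω : ℝ → ℝ} (hω : ContinuousOn ω (Ioc 0 1)) {r : ℝ}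
    (hr : r ∈ Ioc (0 : ℝ) 1) :
    HasDerivWithinAt (fun x => ∫ t in x..(1 : ℝ), ω t) (-ω r) (Ioc 0 1) r := by
  set W : ℝ → ℝ := fun t => ω (min t 1)
  have hW : ContinuousOn W (Ioi 0) :=
    hω.comp (by fun_prop) fun t ht => ⟨lt_min ht one_pos, min_le_right _ _⟩
  have hWω : ∀ t ≤ 1, W t = ω t := fun t ht => by simp only [W, min_eq_left ht]
  have hint : IntervalIntegrable W volume r 1 :=
    (hW.mono fun t ht => hr.1.trans_le ht.1).intervalIntegrable_of_Icc hr.2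
  have hderiv := intervalIntegral.integral_hasDerivAt_left hint
    (hW.stronglyMeasurableAtFilter isOpen_Ioi r hr.1) (hW.continuousAt (Ioi_mem_nhds hr.1))
  rw [hWω r hr.2] at hderiv
  have hcongr : ∀ x ∈ Ioc (0 : ℝ) 1, ∫ t in x..(1 : ℝ), ω t = ∫ t in x..(1 : ℝ), W t :=
    fun x hx => intervalIntegral.integral_congr fun t ht => by
      rw [uIcc_of_le hx.2] at ht
      exact (hWω t ht.2).symm
  exact hderiv.hasDerivWithinAt.congr hcongr (hcongr r hr)

/-- If the integral of a positive function over `(0, 1]` diverges, its tails are unbounded. -/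
theorem exists_le_integral_of_lintegral_eq_top {ω : ℝ → ℝ} (hω : ContinuousOn ω (Ioc 0 1))
    (hpos : ∀ r ∈ Ioc (0 : ℝ) 1, 0 < ω r)
    (hdiv : (∫⁻ r in Ioc (0 : ℝ) 1, ENNReal.ofReal (ω r)) = ⊤) (M : ℝ) :
    ∃ r ∈ Ioc (0 : ℝ) 1, M ≤ ∫ t in r..(1 : ℝ), ω t := by
  by_contra! hM
  have hmem : ∀ n : ℕ, (1 : ℝ) / (n + 1) ∈ Ioc (0 : ℝ) 1 := fun n =>
    ⟨Nat.one_div_pos_of_nat, div_le_one_of_le₀ (by linarith [n.cast_nonneg (α := ℝ)])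
      (by positivity)⟩
  have hint : IntegrableOn ω (Ioc 0 1) := by
    refine integrableOn_Ioc_of_intervalIntegral_norm_bounded_left (I := M)
      (a := fun n : ℕ => (1 : ℝ) / (n + 1)) (l := atTop)
      (fun n => (hω.intervalIntegrable_of_mem_Ioc (hmem n)).1)
      tendsto_one_div_add_atTop_nhds_zero_nat (Eventually.of_forall fun n => ?_)
    have hnorm : ∫ x in Ioc ((1 : ℝ) / (n + 1)) 1, ‖ω x‖ = ∫ x in Ioc ((1 : ℝ) / (n + 1)) 1, ω x :=
      setIntegral_congr_fun measurableSet_Ioc fun x hx =>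
        Real.norm_of_nonneg (hpos x ⟨(hmem n).1.trans hx.1, hx.2⟩).le
    rw [hnorm, ← intervalIntegral.integral_of_le (hmem n).2]
    exact (hM _ (hmem n)).le
  exact hint.lintegral_lt_top.ne hdiv

theorem stmt17 (N : ℕ) (hN : 3 ≤ N) (Ψ ω ω' ω'' : ℝ → ℝ)
    (hΨc : ContinuousOn Ψ (Set.Ioc 0 1))
    (hωd1 : ∀ r ∈ Set.Ioc (0:ℝ) 1, HasDerivWithinAt ω (ω' r) (Set.Ioc 0 1) r)
    (hωd2 : ∀ r ∈ Set.Ioc (0:ℝ) 1, HasDerivWithinAt ω' (ω'' r) (Set.Ioc 0 1) r)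
    (hωd3 : ContinuousOn ω'' (Set.Ioc 0 1))
    (hωpos : ∀ r ∈ Set.Ioc (0:ℝ) 1, 0 < ω r)
    (hode : ∀ r ∈ Set.Ioc (0:ℝ) 1,
      ω'' r + ((N:ℝ) - 1) / r * ω' r + (Ψ r - ((N:ℝ) - 1) / r ^ 2) * ω r = 0)
    (hdiv : (∫⁻ r in Set.Ioc (0:ℝ) 1, ENNReal.ofReal (ω r)) = ⊤)
    (u : ℝ → ℝ) (hu : ∀ r : ℝ, u r = ∫ t in r..(1:ℝ), ω t) :
    StrictAntiOn u (Set.Ioc 0 1) ∧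
    Set.BijOn u (Set.Ioc 0 1) (Set.Ici 0) ∧
    ContDiffOn ℝ 3 u (Set.Ioc 0 1) ∧
    ∃ f : ℝ → ℝ, ContDiffOn ℝ 1 f (Set.Ici 0) ∧
      (∀ r ∈ Set.Ioc (0:ℝ) 1,
        f (u r) = -(derivWithin (derivWithin u (Set.Ioc 0 1)) (Set.Ioc 0 1) r)
          - ((N:ℝ) - 1) / r * derivWithin u (Set.Ioc 0 1) r) ∧
      (∀ r ∈ Set.Ioc (0:ℝ) 1, derivWithin f (Set.Ici 0) (u r) = Ψ r) := by
  set s : Set ℝ := Ioc 0 1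
  have hs : UniqueDiffOn ℝ s := uniqueDiffOn_Ioc 0 1
  obtain rfl : u = fun r => ∫ t in r..(1 : ℝ), ω t := funext hu
  clear hu
  set u : ℝ → ℝ := fun r => ∫ t in r..(1 : ℝ), ω t with hu
  have hωc : ContinuousOn ω s := fun r hr => (hωd1 r hr).continuousWithinAt
  have hu' : ∀ r ∈ s, HasDerivWithinAt u (-ω r) s r :=
    fun r hr => hasDerivWithinAt_integral_Ioc hωc hr
  have huc : ContinuousOn u s := fun r hr => (hu' r hr).continuousWithinAt
  have hanti : StrictAntiOn u s := by
    refine strictAntiOn_of_deriv_neg (convex_Ioc 0 1) huc fun r hr => ?_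
    have hrs : r ∈ s := interior_subset hr
    rw [((hu' r hrs).hasDerivAt (mem_interior_iff_mem_nhds.1 hr)).deriv]
    exact neg_neg_of_pos (hωpos r hrs)
  have h1 : (1 : ℝ) ∈ s := right_mem_Ioc.2 one_pos
  have hu1 : u 1 = 0 := intervalIntegral.integral_same
  have hbij : BijOn u s (Ici 0) := by
    refine ⟨fun r hr => ?_, hanti.injOn, fun y hy => ?_⟩
    · exact hu1 ▸ hanti.antitoneOn hr h1 hr.2
    · obtain ⟨r, hr, hyr⟩ := exists_le_integral_of_lintegral_eq_top hωc hωpos hdiv y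
      have hsub : Icc r 1 ⊆ s := fun t ht => ⟨hr.1.trans_le ht.1, ht.2⟩
      obtain ⟨t, ht, rfl⟩ := intermediate_value_Icc' hr.2 (huc.mono hsub) ⟨hu1.trans_le hy, hyr⟩
      exact ⟨t, hsub ht, rfl⟩
  have hω'2 : ContDiffOn ℝ 2 ω s :=
    contDiffOn_succ_of_hasDerivWithinAt (n := 1) hs hωd1
      (contDiffOn_succ_of_hasDerivWithinAt (n := 0) hs hωd2 (contDiffOn_zero.2 hωd3))
  refine ⟨hanti, hbij,
    contDiffOn_succ_of_hasDerivWithinAt (n := 2) hs hu' hω'2.neg, ?_⟩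
  have hinv : InvOn (Function.invFunOn u s) u s (Ici 0) := hbij.invOn_invFunOn
  set v := Function.invFunOn u s
  have hvmaps : MapsTo v (Ici 0) s := (hbij.symm hinv.symm).mapsTo
  have hvc : ContinuousOn v (Ici 0) :=
    hanti.continuousOn_of_invOn hbij hinv ordConnected_Ioc ordConnected_Ici
  set g : ℝ → ℝ := fun r => ω' r + ((N : ℝ) - 1) / r * ω r
  have hg : ∀ r ∈ s, HasDerivWithinAt g (-(Ψ r * ω r)) s r := by
    intro r hr
    have hr0 : r ≠ 0 := hr.1.ne'
    have hquot : HasDerivWithinAt (fun x : ℝ => ((N : ℝ) - 1) / x) (-((N : ℝ) - 1) / r ^ 2) s r := by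
      simpa using (hasDerivWithinAt_const r s ((N : ℝ) - 1)).fun_div (hasDerivWithinAt_id r s) hr0
    refine ((hωd2 r hr).add (hquot.mul (hωd1 r hr))).congr_deriv ?_
    linear_combination hode r hr
  have hf : ∀ y ∈ Ici (0 : ℝ), HasDerivWithinAt (g ∘ v) (Ψ (v y)) (Ici 0) y := by
    intro y hy
    have hvy := hvmaps hy
    have hω0 := (hωpos _ hvy).ne'
    have hv' := (hu' _ hvy).of_invOn (neg_ne_zero.2 hω0) hvc hvmaps hinv.2 hy
    refine ((hg _ hvy).comp y hv' hvmaps).congr_deriv ?_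
    field_simp
  refine ⟨g ∘ v, ?_, fun r hr => ?_, fun r hr => ?_⟩
  · exact contDiffOn_succ_of_hasDerivWithinAt (n := 0) (uniqueDiffOn_Ici 0) hf
      (contDiffOn_zero.2 (hΨc.comp hvc hvmaps))
  · have hderiv : EqOn (derivWithin u s) (fun x => -ω x) s :=
      fun x hx => (hu' x hx).derivWithin (hs x hx)
    have hvr : v (u r) = r := hinv.1 hr
    rw [derivWithin_congr hderiv (hderiv hr), (hωd1 r hr).fun_neg.derivWithin (hs r hr), hderiv hr,
      Function.comp_apply, hvr]
    simp only [g]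
    ring
  · rw [(hf _ (hbij.mapsTo hr)).derivWithin (uniqueDiffOn_Ici 0 _ (hbij.mapsTo hr)), hinv.1 hr]
end
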